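/- arXiv:1007.5213 — 2 statements merged into one kernel-verified Lean document; each statement's English description precedes it below -/
import Mathlib

section
/- (Theorem 1, left tangential bound.) Let μ ∈ ℂ be such that K(μ) and K̂r(μ) are invertible. Let ŵ be the i-th column of Ŵ, c : Fin p → ℂ, and ξ := (K(μ))ᴴ *ᵥ ŵ − (C(μ))ᴴ *ᵥ c. Let Ξ̂ be the orthogonal projector onto the column span of V̂, i.e. Ξ̂ᴴ = Ξ̂, Ξ̂ * Ξ̂ = Ξ̂, Ξ̂ * V̂ = V̂, and Ξ̂ = V̂ * Y for some matrix Y. Then ‖(star c) ᵥ* Ĥr(μ) − (star c) ᵥ* H(μ)‖ ≤ ‖ξ‖ · ‖1 − Q̂(μ)‖ · ‖(1 − Ξ̂) * (K(μ))⁻¹ * B(μ)‖, where (star c) ᵥ* M denotes the row vector cᴴM. -/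
open Matrix

/-- Euclidean norm of a vector. -/
noncomputable def vnorm {k : ℕ} (x : Fin k → ℂ) : ℝ :=
  ‖(WithLp.equiv 2 (Fin k → ℂ)).symm x‖

/-- Spectral (Euclidean operator) norm of a matrix. -/
noncomputable def mnorm {k l : ℕ} (M : Matrix (Fin k) (Fin l) ℂ) : ℝ :=
  ‖LinearMap.toContinuousLinearMap (Matrix.toEuclideanLin M)‖

section SpectralNorm

open scoped Matrix.Norms.L2Operator

theorem mnorm_mul_le {k l q : ℕ} (M : Matrix (Fin k) (Fin l) ℂ) (N : Matrix (Fin l) (Fin q) ℂ) :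
    mnorm (M * N) ≤ mnorm M * mnorm N :=
  Matrix.l2_opNorm_mul M N

theorem mnorm_conjTranspose {k l : ℕ} (M : Matrix (Fin k) (Fin l) ℂ) : mnorm Mᴴ = mnorm M :=
  Matrix.l2_opNorm_conjTranspose M

theorem vnorm_mulVec_le {k l : ℕ} (M : Matrix (Fin k) (Fin l) ℂ) (x : Fin l → ℂ) :
    vnorm (M *ᵥ x) ≤ mnorm M * vnorm x :=
  Matrix.l2_opNorm_mulVec M (WithLp.toLp 2 x)

end SpectralNorm

theorem vnorm_nonneg {k : ℕ} (x : Fin k → ℂ) : 0 ≤ vnorm x := norm_nonneg _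

theorem vnorm_star {k : ℕ} (x : Fin k → ℂ) : vnorm (star x) = vnorm x := by
  simp [vnorm, EuclideanSpace.norm_eq]

theorem vnorm_star_vecMul_le {k l : ℕ} (x : Fin k → ℂ) (M : Matrix (Fin k) (Fin l) ℂ) :
    vnorm (star x ᵥ* M) ≤ vnorm x * mnorm M := by
  have h : star x ᵥ* M = star (Mᴴ *ᵥ x) := by
    rw [Matrix.star_mulVec, Matrix.conjTranspose_conjTranspose]
  rw [h, vnorm_star, mul_comm, ← mnorm_conjTranspose M]
  exact vnorm_mulVec_le _ _

/-- Theorem 1 (left tangential bound). -/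
theorem left_tangential_interpolation_error_bound
    {n m p r : ℕ} (hn : 0 < n) (hm : 0 < m) (hp : 0 < p) (hr : 0 < r)
    (K : ℂ → Matrix (Fin n) (Fin n) ℂ)
    (B : ℂ → Matrix (Fin n) (Fin m) ℂ)
    (C : ℂ → Matrix (Fin p) (Fin n) ℂ)
    (Vh Wh : Matrix (Fin n) (Fin r) ℂ)
    (Krh : ℂ → Matrix (Fin r) (Fin r) ℂ)
    (hKrh : Krh = fun s => Whᴴ * K s * Vh)
    (H Hh : ℂ → Matrix (Fin p) (Fin m) ℂ)
    (hH : H = fun s => C s * (K s)⁻¹ * B s)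
    (hHh : Hh = fun s => C s * Vh * (Krh s)⁻¹ * Whᴴ * B s)
    (Qh : ℂ → Matrix (Fin n) (Fin n) ℂ)
    (hQh : Qh = fun s => Vh * (Krh s)⁻¹ * Whᴴ * K s)
    (μ : ℂ) (hKμ : IsUnit (K μ)) (hKrμ : IsUnit (Krh μ))
    (wh : Fin n → ℂ) (i : Fin r) (hwh : ∀ k, wh k = Wh k i)
    (c : Fin p → ℂ) (ξ : Fin n → ℂ)
    (hξ : ξ = (K μ)ᴴ *ᵥ wh - (C μ)ᴴ *ᵥ c)
    -- `Xi` is the orthogonal projector onto the column span of `Vh`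
    (Xi : Matrix (Fin n) (Fin n) ℂ)
    (hXi_herm : Xiᴴ = Xi) (hXi_idem : Xi * Xi = Xi)
    (hXi_fix : Xi * Vh = Vh) (hXi_ran : ∃ Y : Matrix (Fin r) (Fin n) ℂ, Xi = Vh * Y) :
    vnorm ((star c) ᵥ* Hh μ - (star c) ᵥ* H μ) ≤
      vnorm ξ * mnorm (1 - Qh μ) * mnorm ((1 - Xi) * (K μ)⁻¹ * B μ) := by
  subst hKrh hH hHh hQh hξ
  obtain ⟨Y, hY⟩ := hXi_ran
  have hdetK : IsUnit (K μ).det := (Matrix.isUnit_iff_isUnit_det _).1 hKμ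
  have hdetKr : IsUnit (Whᴴ * K μ * Vh).det := (Matrix.isUnit_iff_isUnit_det _).1 hKrμ
  set G := (Whᴴ * K μ * Vh)⁻¹
  set Q := Vh * G * Whᴴ * K μ with hQ
  have hGl : G * (Whᴴ * K μ * Vh) = 1 := Matrix.nonsing_inv_mul _ hdetKr
  have hGr : Whᴴ * K μ * Vh * G = 1 := Matrix.mul_nonsing_inv _ hdetKr
  have hQV : Q * Vh = Vh := by
    calc Q * Vh = Vh * (G * (Whᴴ * K μ * Vh)) := by simp only [hQ, Matrix.mul_assoc]
      _ = Vh := by rw [hGl, Matrix.mul_one]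
  have hQXi : (1 - Q) * Xi = 0 := by
    rw [hY, ← Matrix.mul_assoc, Matrix.sub_mul, hQV, Matrix.one_mul, sub_self, Matrix.zero_mul]
  have hWKQ : Whᴴ * K μ * (1 - Q) = 0 := by
    have : Whᴴ * K μ * Q = Whᴴ * K μ := by
      calc Whᴴ * K μ * Q = (Whᴴ * K μ * Vh * G) * (Whᴴ * K μ) := by
            simp only [hQ, Matrix.mul_assoc]
        _ = Whᴴ * K μ := by rw [hGr, Matrix.one_mul]
    rw [Matrix.mul_sub, Matrix.mul_one, this, sub_self]
  have hwhW : star wh = Pi.single i 1 ᵥ* Whᴴ := by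
    ext k
    simp [hwh]
  have hwhQ : star wh ᵥ* (K μ * (1 - Q)) = 0 := by
    rw [hwhW, Matrix.vecMul_vecMul, ← Matrix.mul_assoc, hWKQ, Matrix.vecMul_zero]
  have hξ : star ((K μ)ᴴ *ᵥ wh - (C μ)ᴴ *ᵥ c) = star wh ᵥ* K μ - star c ᵥ* C μ := by
    rw [star_sub, Matrix.star_mulVec, Matrix.star_mulVec, Matrix.conjTranspose_conjTranspose,
      Matrix.conjTranspose_conjTranspose]
  have hQKinv : Q * (K μ)⁻¹ = Vh * G * Whᴴ := by
    rw [hQ, Matrix.mul_assoc, Matrix.mul_nonsing_inv _ hdetK, Matrix.mul_one]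
  have herr : star c ᵥ* (C μ * Vh * G * Whᴴ * B μ) - star c ᵥ* (C μ * (K μ)⁻¹ * B μ) =
      star ((K μ)ᴴ *ᵥ wh - (C μ)ᴴ *ᵥ c) ᵥ* ((1 - Q) * ((1 - Xi) * (K μ)⁻¹ * B μ)) := by
    have hproj : (1 - Q) * ((1 - Xi) * (K μ)⁻¹ * B μ) = (1 - Q) * ((K μ)⁻¹ * B μ) := by
      rw [Matrix.mul_assoc (1 - Xi), ← Matrix.mul_assoc (1 - Q), Matrix.mul_sub (1 - Q), hQXi,
        Matrix.mul_one, sub_zero]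
    have hred : C μ * Vh * G * Whᴴ * B μ = C μ * (Q * (K μ)⁻¹ * B μ) := by
      rw [hQKinv]
      simp only [Matrix.mul_assoc]
    have hw : star wh ᵥ* (K μ * ((1 - Q) * ((K μ)⁻¹ * B μ))) = 0 := by
      rw [← Matrix.mul_assoc (K μ), ← Matrix.vecMul_vecMul, hwhQ, Matrix.zero_vecMul]
    rw [hproj, hξ, Matrix.sub_vecMul, Matrix.vecMul_vecMul, Matrix.vecMul_vecMul, hw, zero_sub,
      hred, ← Matrix.vecMul_sub, ← Matrix.vecMul_neg]
    congr 1
    simp only [Matrix.mul_sub, Matrix.sub_mul, Matrix.one_mul, Matrix.mul_assoc, neg_sub]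
  calc _ = vnorm (star ((K μ)ᴴ *ᵥ wh - (C μ)ᴴ *ᵥ c) ᵥ*
        ((1 - Q) * ((1 - Xi) * (K μ)⁻¹ * B μ))) := congrArg vnorm herr
    _ ≤ vnorm ((K μ)ᴴ *ᵥ wh - (C μ)ᴴ *ᵥ c) * mnorm ((1 - Q) * ((1 - Xi) * (K μ)⁻¹ * B μ)) :=
        vnorm_star_vecMul_le _ _
    _ ≤ vnorm ((K μ)ᴴ *ᵥ wh - (C μ)ᴴ *ᵥ c) *
        (mnorm (1 - Q) * mnorm ((1 - Xi) * (K μ)⁻¹ * B μ)) :=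
        mul_le_mul_of_nonneg_left (mnorm_mul_le _ _) (vnorm_nonneg _)
    _ = _ := (mul_assoc _ _ _).symm
end

section
/- (Theorem 3, pointwise form.) Let s ∈ ℂ be such that K(s), Kr(s) := Wᴴ * K(s) * V, and K̂r(s) := Ŵᴴ * K(s) * V̂ are all invertible. Let Ξ, Ξ̂, Π, Π̂ be the orthogonal projectors onto the column spans of V, V̂, W, Ŵ respectively; that is, each is Hermitian and idempotent, Ξ * V = V and Ξ = V * X₁, Ξ̂ * V̂ = V̂ and Ξ̂ = V̂ * X₂, Π * W = W and Π = W * X₃, Π̂ * Ŵ = Ŵ and Π̂ = Ŵ * X₄, for some matrices X₁, X₂, X₃, X₄. Then ‖H_r(s) − Ĥr(s)‖ ≤ ‖C(s)‖ · ‖1 − Q̂(s)‖ · ‖(1 − Ξ̂) * Ξ‖ · ‖Q(s) * (K(s))⁻¹ * B(s)‖ + ‖C(s) * (K(s))⁻¹ * P̂(s)‖ · ‖Π̂ * (1 − Π)‖ · ‖1 − P(s)‖ · ‖B(s)‖. -/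
open Matrix

section SpectralNorm

open scoped Matrix.Norms.L2Operator

theorem mnorm_eq_l2_opNorm {k l : ℕ} (M : Matrix (Fin k) (Fin l) ℂ) : mnorm M = ‖M‖ := rfl

theorem mnorm_nonneg {k l : ℕ} (M : Matrix (Fin k) (Fin l) ℂ) : 0 ≤ mnorm M :=
  norm_nonneg _

theorem mnorm_sub_le {k l : ℕ} (M N : Matrix (Fin k) (Fin l) ℂ) :
    mnorm (M - N) ≤ mnorm M + mnorm N := by
  simpa only [mnorm_eq_l2_opNorm] using norm_sub_le M N

theorem mnorm_mul_mul_mul_le {k l q i j : ℕ} (M : Matrix (Fin k) (Fin l) ℂ)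
    (N : Matrix (Fin l) (Fin q) ℂ) (S : Matrix (Fin q) (Fin i) ℂ) (T : Matrix (Fin i) (Fin j) ℂ) :
    mnorm (M * N * S * T) ≤ mnorm M * mnorm N * mnorm S * mnorm T := by
  refine (mnorm_mul_le _ _).trans (mul_le_mul_of_nonneg_right ?_ (mnorm_nonneg _))
  refine (mnorm_mul_le _ _).trans (mul_le_mul_of_nonneg_right ?_ (mnorm_nonneg _))
  exact mnorm_mul_le _ _

end SpectralNorm

/-- Theorem 3 (pointwise form): bound on the deviation between exactly and inexactly
computed reduced transfer functions. -/
theorem exact_vs_inexact_pointwise_bound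
    {n m p r : ℕ} (hn : 0 < n) (hm : 0 < m) (hp : 0 < p) (hr : 0 < r)
    (K : ℂ → Matrix (Fin n) (Fin n) ℂ)
    (B : ℂ → Matrix (Fin n) (Fin m) ℂ)
    (C : ℂ → Matrix (Fin p) (Fin n) ℂ)
    (V W Vh Wh : Matrix (Fin n) (Fin r) ℂ)
    (Hr Hh : ℂ → Matrix (Fin p) (Fin m) ℂ)
    (hHr : Hr = fun s => C s * V * (Wᴴ * K s * V)⁻¹ * Wᴴ * B s)
    (hHh : Hh = fun s => C s * Vh * (Whᴴ * K s * Vh)⁻¹ * Whᴴ * B s)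
    (P Q Ph Qh : ℂ → Matrix (Fin n) (Fin n) ℂ)
    (hP : P = fun s => K s * V * (Wᴴ * K s * V)⁻¹ * Wᴴ)
    (hQ : Q = fun s => V * (Wᴴ * K s * V)⁻¹ * Wᴴ * K s)
    (hPh : Ph = fun s => K s * Vh * (Whᴴ * K s * Vh)⁻¹ * Whᴴ)
    (hQh : Qh = fun s => Vh * (Whᴴ * K s * Vh)⁻¹ * Whᴴ * K s)
    (s : ℂ) (hK : IsUnit (K s))
    (hKr : IsUnit (Wᴴ * K s * V)) (hKrh : IsUnit (Whᴴ * K s * Vh))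
    -- orthogonal projectors onto the column spans of V, Vh, W, Wh
    (Xi Xih Pi Pih : Matrix (Fin n) (Fin n) ℂ)
    (hXi_herm : Xiᴴ = Xi) (hXi_idem : Xi * Xi = Xi)
    (hXi_fix : Xi * V = V) (hXi_ran : ∃ X₁ : Matrix (Fin r) (Fin n) ℂ, Xi = V * X₁)
    (hXih_herm : Xihᴴ = Xih) (hXih_idem : Xih * Xih = Xih)
    (hXih_fix : Xih * Vh = Vh) (hXih_ran : ∃ X₂ : Matrix (Fin r) (Fin n) ℂ, Xih = Vh * X₂)
    (hPi_herm : Piᴴ = Pi) (hPi_idem : Pi * Pi = Pi)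
    (hPi_fix : Pi * W = W) (hPi_ran : ∃ X₃ : Matrix (Fin r) (Fin n) ℂ, Pi = W * X₃)
    (hPih_herm : Pihᴴ = Pih) (hPih_idem : Pih * Pih = Pih)
    (hPih_fix : Pih * Wh = Wh) (hPih_ran : ∃ X₄ : Matrix (Fin r) (Fin n) ℂ, Pih = Wh * X₄) :
    mnorm (Hr s - Hh s) ≤
      mnorm (C s) * mnorm (1 - Qh s) * mnorm ((1 - Xih) * Xi) *
          mnorm (Q s * (K s)⁻¹ * B s) +
        mnorm (C s * (K s)⁻¹ * Ph s) * mnorm (Pih * (1 - Pi)) * mnorm (1 - P s) *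
          mnorm (B s) := by
  subst hHr hHh hP hQ hPh hQh
  obtain ⟨X₂, hX₂⟩ := hXih_ran
  obtain ⟨X₃, hX₃⟩ := hPi_ran
  have hKdet := (Matrix.isUnit_iff_isUnit_det _).mp hK
  have hKrdet := (Matrix.isUnit_iff_isUnit_det _).mp hKr
  have hKrhdet := (Matrix.isUnit_iff_isUnit_det _).mp hKrh
  beta_reduce
  generalize hR : V * (Wᴴ * K s * V)⁻¹ * Wᴴ = R
  generalize hRh : Vh * (Whᴴ * K s * Vh)⁻¹ * Whᴴ = Rh
  have hP : K s * V * (Wᴴ * K s * V)⁻¹ * Wᴴ = K s * R := by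
    simp only [← hR, Matrix.mul_assoc]
  have hPh : K s * Vh * (Whᴴ * K s * Vh)⁻¹ * Whᴴ = K s * Rh := by
    simp only [← hRh, Matrix.mul_assoc]
  have hH : C s * V * (Wᴴ * K s * V)⁻¹ * Wᴴ * B s = C s * R * B s := by
    simp only [← hR, Matrix.mul_assoc]
  have hHh : C s * Vh * (Whᴴ * K s * Vh)⁻¹ * Whᴴ * B s = C s * Rh * B s := by
    simp only [← hRh, Matrix.mul_assoc]
  rw [hP, hPh, hH, hHh]
  have hQK : R * K s * (K s)⁻¹ = R := Matrix.mul_nonsing_inv_cancel_right _ _ hKdet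
  have hKP : C s * (K s)⁻¹ * (K s * Rh) = C s * Rh := by
    rw [Matrix.mul_assoc, Matrix.nonsing_inv_mul_cancel_left _ _ hKdet]
  rw [hQK, hKP]
  have hXiR : Xi * R = R := by
    simp only [← hR, ← Matrix.mul_assoc, hXi_fix]
  have hRhPih : Rh * Pih = Rh := by
    have h : Whᴴ * Pih = Whᴴ := by
      simpa [hPih_herm] using congrArg Matrix.conjTranspose hPih_fix
    rw [← hRh, Matrix.mul_assoc, h]
  have hQhXih : Rh * K s * Xih = Xih := by
    have h : Rh * K s * Vh = Vh := by
      calc Rh * K s * Vh = Vh * ((Whᴴ * K s * Vh)⁻¹ * (Whᴴ * K s * Vh)) := by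
            simp only [← hRh, Matrix.mul_assoc]
        _ = Vh := by rw [Matrix.nonsing_inv_mul _ hKrhdet, Matrix.mul_one]
    rw [hX₂, ← Matrix.mul_assoc, h]
  have hPiP : Pi * (K s * R) = Pi := by
    have h : Wᴴ * (K s * R) = Wᴴ := by
      calc Wᴴ * (K s * R) = (Wᴴ * K s * V) * (Wᴴ * K s * V)⁻¹ * Wᴴ := by
            simp only [← hR, Matrix.mul_assoc]
        _ = Wᴴ := by rw [Matrix.mul_nonsing_inv _ hKrdet, Matrix.one_mul]
    have hPi : Pi = X₃ᴴ * Wᴴ := by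
      rw [← Matrix.conjTranspose_mul, ← hX₃, hPi_herm]
    rw [hPi, Matrix.mul_assoc, h]
  have hleft : (1 - Rh * K s) * ((1 - Xih) * Xi) * R = R - Rh * K s * R := by
    calc (1 - Rh * K s) * ((1 - Xih) * Xi) * R
        = (1 - Rh * K s - (Xih - Rh * K s * Xih)) * (Xi * R) := by noncomm_ring
      _ = R - Rh * K s * R := by rw [hQhXih, hXiR]; noncomm_ring
  have hright : Rh * (Pih * (1 - Pi)) * (1 - K s * R) = Rh - Rh * K s * R := by
    calc Rh * (Pih * (1 - Pi)) * (1 - K s * R)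
        = Rh * Pih * (1 - K s * R - (Pi - Pi * (K s * R))) := by noncomm_ring
      _ = Rh - Rh * K s * R := by rw [hPiP, hRhPih]; noncomm_ring
  have hdecomp : C s * R * B s - C s * Rh * B s =
      C s * (1 - Rh * K s) * ((1 - Xih) * Xi) * (R * B s) -
        C s * Rh * (Pih * (1 - Pi)) * (1 - K s * R) * B s := by
    calc C s * R * B s - C s * Rh * B s
        = C s * (R - Rh * K s * R) * B s - C s * (Rh - Rh * K s * R) * B s := by
          simp only [Matrix.mul_sub, Matrix.sub_mul]; abel
      _ = _ := by rw [← hleft, ← hright]; simp only [Matrix.mul_assoc]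
  rw [hdecomp]
  exact (mnorm_sub_le _ _).trans
    (add_le_add (mnorm_mul_mul_mul_le _ _ _ _) (mnorm_mul_mul_mul_le _ _ _ _))
end
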